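/- Let m be a positive integer and let u⁽¹⁾, …, u⁽ᵏ⁾ be orthonormal vectors in R^m with κ ≥ m/2. Let ε ∈ (0,1). Then there exist absolute constants c₅, c₆, c₇ > 0 and coefficients β₁, …, β_κ such that u = Σ_{i=1}^{κ} βᵢ u⁽ⁱ⁾ is a unit vector and Σ_{j=1}^{m} uⱼ² · 1{ uⱼ ≥ c₅/√(ε m) } ≤ c₇ · exp(−c₆/ε). -/

import Mathlib

open Finset

/-- The sum over all sign patterns of `exp (∑ i, ± a i)` satisfies a sub-Gaussian bound. -/
theorem sum_exp_signs_le {ι : Type*} [Fintype ι] [DecidableEq ι] (a : ι → ℝ) :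
    ∑ s : ι → Bool, Real.exp (∑ i, (if s i then 1 else -1) * a i) ≤
      2 ^ Fintype.card ι * Real.exp ((∑ i, a i ^ 2) / 2) := by
  have h : ∑ s : ι → Bool, Real.exp (∑ i, (if s i then 1 else -1) * a i) =
      ∏ i, (2 * Real.cosh (a i)) := by
    simp_rw [Real.exp_sum]
    rw [← Fintype.prod_sum (fun i (b : Bool) => Real.exp ((if b then 1 else -1) * a i))]
    refine prod_congr rfl fun i _ => ?_
    simp [Real.cosh_eq]
    ring
  rw [h, prod_mul_distrib, prod_const, card_univ, sum_div, Real.exp_sum]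
  gcongr with i
  exact Real.cosh_le_exp_half_sq _

theorem sq_le_exp_of_le {T x : ℝ} (hT : 0 ≤ T) (hx : T ≤ x) :
    x ^ 2 ≤ 2 * Real.exp ((1 + T) * x - T ^ 2) := by
  have h1 := Real.quadratic_le_exp_of_nonneg (hT.trans hx)
  have h2 : Real.exp x ≤ Real.exp ((1 + T) * x - T ^ 2) := by
    gcongr
    nlinarith
  nlinarith

theorem Orthonormal.sum_sq_apply_le_one {ι n : Type*} [Fintype ι] [Fintype n]
    {u : ι → EuclideanSpace ℝ n} (hu : Orthonormal ℝ u) (j : n) :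
    ∑ i, u i j ^ 2 ≤ 1 := by
  classical
  have h := hu.sum_inner_products_le (EuclideanSpace.single j (1 : ℝ)) (s := univ)
  simpa [EuclideanSpace.inner_single_right] using h

theorem Orthonormal.norm_sum_smul_eq_one {ι E : Type*} [Fintype ι] [NormedAddCommGroup E]
    [InnerProductSpace ℝ E] {u : ι → E} (hu : Orthonormal ℝ u) {β : ι → ℝ}
    (hβ : ∑ i, β i ^ 2 = 1) : ‖∑ i, β i • u i‖ = 1 := by
  have h : ‖∑ i, β i • u i‖ ^ 2 = 1 := by
    rw [← real_inner_self_eq_norm_sq, hu.inner_sum, ← hβ]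
    simp [sq]
  exact (pow_eq_one_iff_of_nonneg (norm_nonneg _) two_ne_zero).1 h

/-- The truncated second moment of a Rademacher sum with coefficients in the unit ball. -/
theorem sum_signs_sq_tail_le {ι : Type*} [Fintype ι] [DecidableEq ι] {a : ι → ℝ}
    (ha : ∑ i, a i ^ 2 ≤ 1) {T : ℝ} (hT : 0 ≤ T) :
    ∑ s : ι → Bool, (if T ≤ ∑ i, (if s i then 1 else -1) * a i
        then (∑ i, (if s i then 1 else -1) * a i) ^ 2 else 0) ≤
      2 ^ Fintype.card ι * (2 * Real.exp (3 / 2 - T ^ 2 / 4)) := by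
  calc
    _ ≤ ∑ s : ι → Bool, 2 * Real.exp (-T ^ 2) *
          Real.exp (∑ i, (if s i then 1 else -1) * ((1 + T) * a i)) := by
      refine sum_le_sum fun s _ => ?_
      have e : ∑ i, (if s i then (1 : ℝ) else -1) * ((1 + T) * a i) =
          (1 + T) * ∑ i, (if s i then 1 else -1) * a i := by
        rw [mul_sum]
        exact sum_congr rfl fun i _ => by ring
      split_ifs with h
      · rw [e, mul_assoc, ← Real.exp_add, neg_add_eq_sub]
        exact sq_le_exp_of_le hT h
      · positivity
    _ ≤ 2 * Real.exp (-T ^ 2) *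
          (2 ^ Fintype.card ι * Real.exp ((∑ i, ((1 + T) * a i) ^ 2) / 2)) := by
      rw [← mul_sum]
      gcongr
      exact sum_exp_signs_le _
    _ = 2 ^ Fintype.card ι *
          (2 * Real.exp (-T ^ 2 + (1 + T) ^ 2 * (∑ i, a i ^ 2) / 2)) := by
      rw [Real.exp_add]
      simp_rw [mul_pow]
      rw [← mul_sum]
      ring
    _ ≤ _ := by
      gcongr
      nlinarith [mul_le_mul_of_nonneg_left ha (sq_nonneg (1 + T)), sq_nonneg (T - 2)]

/-- there are absolute constants `c₅, c₆, c₇ > 0` such that for every `m ≥ 1`,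
every family of `κ ≥ m/2` orthonormal vectors `u⁽¹⁾, …, u⁽ᵏ⁾` in `ℝ^m`, and every
`ε ∈ (0,1)`, there exist coefficients `β` making `u = Σᵢ βᵢ u⁽ⁱ⁾` a unit vector whose total
squared mass on coordinates `≥ c₅/√(εm)` is at most `c₇ · exp(−c₆/ε)`. -/
theorem stmt14 :
    ∃ c₅ c₆ c₇ : ℝ, 0 < c₅ ∧ 0 < c₆ ∧ 0 < c₇ ∧
      ∀ (m κ : ℕ), 0 < m → m ≤ 2 * κ →
        ∀ u : Fin κ → EuclideanSpace ℝ (Fin m), Orthonormal ℝ u →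
          ∀ ε : ℝ, 0 < ε → ε < 1 →
            ∃ β : Fin κ → ℝ,
              ‖∑ i, β i • u i‖ = 1 ∧
              (∑ j : Fin m,
                  if c₅ / Real.sqrt (ε * m) ≤ (∑ i, β i • u i) j
                  then ((∑ i, β i • u i) j) ^ 2 else 0)
                ≤ c₇ * Real.exp (-c₆ / ε) := by
  refine ⟨2, 1 / 2, 4 * Real.exp (3 / 2), by norm_num, by norm_num, by positivity, ?_⟩
  intro m κ hm hmκ u hu ε hε _
  have hm' : (0 : ℝ) < m := by exact_mod_cast hm
  have hκ : (0 : ℝ) < κ := by exact_mod_cast (by omega : 0 < κ)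
  have hmκ' : (m : ℝ) ≤ 2 * κ := by exact_mod_cast hmκ
  set T := Real.sqrt (2 / ε) with hTdef
  have hT2 : T ^ 2 = 2 / ε := Real.sq_sqrt (by positivity)
  have hthr : T ≤ Real.sqrt κ * (2 / Real.sqrt (ε * m)) := by
    refine Real.sqrt_le_iff.2 ⟨by positivity, ?_⟩
    rw [mul_pow, div_pow, Real.sq_sqrt hκ.le, Real.sq_sqrt (by positivity), ← mul_div_assoc,
      div_le_div_iff₀ hε (by positivity)]
    nlinarith
  let σ : (Fin κ → Bool) → Fin κ → ℝ := fun s i => if s i then 1 else -1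
  let β : (Fin κ → Bool) → Fin κ → ℝ := fun s i => σ s i / Real.sqrt κ
  have hcoord (s : Fin κ → Bool) (j : Fin m) :
      (∑ i, β s i • u i) j = (∑ i, σ s i * u i j) / Real.sqrt κ := by
    simp only [WithLp.ofLp_sum, WithLp.ofLp_smul, Finset.sum_apply, Pi.smul_apply, smul_eq_mul,
      sum_div, β]
    exact sum_congr rfl fun i _ => by ring
  have hterm (s : Fin κ → Bool) (j : Fin m) :
      (if 2 / Real.sqrt (ε * m) ≤ (∑ i, β s i • u i) j
        then ((∑ i, β s i • u i) j) ^ 2 else 0) ≤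
      (if T ≤ ∑ i, σ s i * u i j then (∑ i, σ s i * u i j) ^ 2 else 0) / κ := by
    rw [hcoord]
    split_ifs with h1 h2 h2
    · rw [div_pow, Real.sq_sqrt hκ.le]
    · rw [le_div_iff₀ (by positivity), mul_comm] at h1
      exact absurd (hthr.trans h1) h2
    · positivity
    · simp
  have hsum : ∑ s : Fin κ → Bool, (∑ j : Fin m,
      if 2 / Real.sqrt (ε * m) ≤ (∑ i, β s i • u i) j
        then ((∑ i, β s i • u i) j) ^ 2 else 0) ≤
      ∑ _s : Fin κ → Bool, 4 * Real.exp (3 / 2) * Real.exp (-(1 / 2) / ε) := by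
    rw [sum_comm]
    calc
      _ ≤ ∑ j : Fin m, 2 ^ κ * (2 * Real.exp (3 / 2 - T ^ 2 / 4)) / κ := by
        refine sum_le_sum fun j _ => (sum_le_sum fun s _ => hterm s j).trans ?_
        rw [← sum_div]
        gcongr
        have h := sum_signs_sq_tail_le (hu.sum_sq_apply_le_one j) (Real.sqrt_nonneg (2 / ε))
        rwa [Fintype.card_fin] at h
      _ = 2 ^ κ * (2 * Real.exp (3 / 2 - T ^ 2 / 4)) * (m / κ) := by
        simp
        ring
      _ ≤ 2 ^ κ * (2 * Real.exp (3 / 2 - T ^ 2 / 4)) * 2 := by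
        gcongr
        rwa [div_le_iff₀ hκ]
      _ = _ := by
        have he : 3 / 2 - T ^ 2 / 4 = 3 / 2 + -(1 / 2) / ε := by
          rw [hT2]
          ring
        rw [he, Real.exp_add]
        simp
        ring
  obtain ⟨s, -, hs⟩ := exists_le_of_sum_le univ_nonempty hsum
  refine ⟨β s, hu.norm_sum_smul_eq_one ?_, hs⟩
  have hsq (i : Fin κ) : β s i ^ 2 = 1 / κ := by
    simp only [β, σ, div_pow, Real.sq_sqrt hκ.le]
    split_ifs <;> norm_num
  simp [hsq, hκ.ne']
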